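/- Let G be a finite simple graph with two distinct non-adjacent vertices u, v and subsets L, R ⊆ V(G) with L ∪ R = V(G), L ∩ R = {u, v}, such that every edge of G has both endpoints in L or both endpoints in R. Suppose the induced subgraphs G[L] and G[R] each contain a path from u to v. Let a, b, c, d be natural numbers such that: the cut ideal I_{G[L]+uv} is generated by polynomials of degree at most a; the cut ideal I_{G[R]+uv} is generated by polynomials of degree at most b; the cut ideal I_{G[L]} has a slow-varying (with respect to u, v) set of binomial generators each of degree at most c; and the cut ideal I_{G[R]} has a slow-varying (with respect to u, v) set of binomial generators each of degree at most d. Then the cut ideal I_G is generated by polynomials of degree at most max{2c − 2, 2d − 2, a, b}. -/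

import Mathlib

open MvPolynomial

noncomputable section

/-- `sep A e` is `true` iff the edge `e` has exactly one endpoint in `A`. -/
def sep {V : Type} [DecidableEq V] (A : Finset V) : Sym2 V → Bool :=
  Sym2.lift ⟨fun a b => (decide (a ∈ A)).xor (decide (b ∈ A)),
    fun _ _ => Bool.xor_comm _ _⟩

/-- The cut map `φ_G : K[q_A : v₀ ∈ A ⊆ V] → K[s_e, t_e : e ∈ E]`, where
`s_e` is the variable `X (e, true)` and `t_e` is the variable `X (e, false)`. -/
def cutMap (K : Type) [Field K] {V : Type} [Fintype V] [DecidableEq V]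
    (G : SimpleGraph V) (v₀ : V) :
    MvPolynomial {A : Finset V // v₀ ∈ A} K →ₐ[K] MvPolynomial (Sym2 V × Bool) K :=
  aeval fun A : {A : Finset V // v₀ ∈ A} =>
    ∏ e ∈ (Set.toFinite G.edgeSet).toFinset, X (e, sep A.1 e)

/-- The cut ideal `I_G`, i.e. the kernel of `φ_G`. -/
def cutIdeal (K : Type) [Field K] {V : Type} [Fintype V] [DecidableEq V]
    (G : SimpleGraph V) (v₀ : V) :
    Ideal (MvPolynomial {A : Finset V // v₀ ∈ A} K) :=
  RingHom.ker (cutMap K G v₀)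

/-- The monomial `q_{A₁} ⋯ q_{Aₙ}` associated to a multiset of cut index sets. -/
def mon (K : Type) [Field K] {V : Type} {v₀ : V}
    (m : Multiset {A : Finset V // v₀ ∈ A}) :
    MvPolynomial {A : Finset V // v₀ ∈ A} K :=
  (m.map X).prod

/-- The height `h_{u,v}` of a monomial `q_{A₁} ⋯ q_{Aₙ}`: the number of `i` such that
exactly one of `u`, `v` belongs to `Aᵢ`. -/
def height {V : Type} [DecidableEq V] (u v : V) {v₀ : V}
    (m : Multiset {A : Finset V // v₀ ∈ A}) : ℕ :=
  Multiset.card (m.filter fun A => sep A.1 s(u, v) = true)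

/-- `G + uv`: the graph `G` with the edge `uv` added. -/
def addEdge {V : Type} (G : SimpleGraph V) (u v : V) : SimpleGraph V :=
  G ⊔ SimpleGraph.fromEdgeSet {s(u, v)}


section Comb

theorem ms_map_eq_add {α β : Type*} (f : α → β) (m : Multiset α) (s t : Multiset β)
    (h : m.map f = s + t) : ∃ a b, m = a + b ∧ a.map f = s ∧ b.map f = t := by
  classical
  induction s using Multiset.induction_on generalizing m with
  | empty => exact ⟨0, m, by simp, by simp, by simpa using h⟩
  | cons x s ih =>
    have hx : x ∈ m.map f := by rw [h]; simp
    obtain ⟨y, hy, rfl⟩ := Multiset.mem_map.1 hx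
    obtain ⟨m', rfl⟩ := Multiset.exists_cons_of_mem hy
    simp only [Multiset.map_cons, Multiset.cons_add, Multiset.cons_inj_right] at h
    obtain ⟨a, b, rfl, ha, hb⟩ := ih m' h
    exact ⟨y ::ₘ a, b, by simp, by simp [ha], hb⟩

theorem ms_le_map {α β : Type*} (f : α → β) (m : Multiset α) (s : Multiset β)
    (h : s ≤ m.map f) : ∃ a b, m = a + b ∧ a.map f = s := by
  obtain ⟨t, ht⟩ := Multiset.le_iff_exists_add.1 h
  obtain ⟨a, b, h1, h2, _⟩ := ms_map_eq_add f m s t ht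
  exact ⟨a, b, h1, h2⟩

theorem ms_bool_ext {s t : Multiset Bool} (h1 : s.card = t.card)
    (h2 : s.count true = t.count true) : s = t := by
  have key : ∀ s : Multiset Bool, s.card = s.count true + s.count false := by
    intro s
    induction s using Multiset.induction_on with
    | empty => simp
    | cons a s ih => cases a <;> simp [ih] <;> omega
  have := key s
  have := key t
  ext b
  cases b <;> omega

theorem ms_bool_card (s : Multiset Bool) : s.card = s.count true + s.count false := by
  induction s using Multiset.induction_on with
  | empty => simp
  | cons a s ih => cases a <;> simp [ih] <;> omega

variable {X Y Z : Type*} (pL : Z → X) (pR : Z → Y) (tX : X → Bool) (tY : Y → Bool)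

theorem pair_exists
    (hsurj : ∀ x y, tX x = tY y → ∃ z, pL z = x ∧ pR z = y)
    (l : Multiset X) (r : Multiset Y) (h : l.map tX = r.map tY) :
    ∃ m : Multiset Z, m.map pL = l ∧ m.map pR = r := by
  induction l using Multiset.induction_on generalizing r with
  | empty =>
    have : r = 0 := by simpa using h.symm
    exact ⟨0, by simp, by simp [this]⟩
  | cons x l ih =>
    have hx : tX x ∈ r.map tY := by rw [← h]; simp
    obtain ⟨y, hy, hxy⟩ := Multiset.mem_map.1 hx
    obtain ⟨r', rfl⟩ := Multiset.exists_cons_of_mem hy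
    simp only [Multiset.map_cons, hxy, Multiset.cons_inj_right] at h
    obtain ⟨m, h1, h2⟩ := ih r' h
    obtain ⟨z, rfl, rfl⟩ := hsurj x y hxy.symm
    exact ⟨z ::ₘ m, by simp [h1], by simp [h2]⟩

theorem quad_connected
    (hτ : ∀ z, tX (pL z) = tY (pR z))
    (hinj : ∀ z z', pL z = pL z' → pR z = pR z' → z = z')
    (hsurj : ∀ x y, tX x = tY y → ∃ z, pL z = x ∧ pR z = y)
    (r : AddCon (Multiset Z))
    (hr : ∀ p q : Multiset Z, p.card ≤ 2 → q.card ≤ 2 → p.map pL = q.map pL →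
      p.map pR = q.map pR → r p q)
    (m m' : Multiset Z) (h1 : m.map pL = m'.map pL) (h2 : m.map pR = m'.map pR) : r m m' := by
  classical
  induction m using Multiset.induction_on generalizing m' with
  | empty =>
    have : m' = 0 := by simpa using h1.symm
    subst this; exact r.refl _
  | cons z m ih =>
    have hx : pL z ∈ m'.map pL := by rw [← h1]; simp
    obtain ⟨z1, hz1, e1⟩ := Multiset.mem_map.1 hx
    have hy : pR z ∈ m'.map pR := by rw [← h2]; simp
    obtain ⟨z2, hz2, e2⟩ := Multiset.mem_map.1 hy
    obtain ⟨m1, rfl⟩ := Multiset.exists_cons_of_mem hz1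
    by_cases h12 : z2 = z1
    · subst h12
      obtain rfl := hinj _ _ e1 e2
      simp only [Multiset.map_cons, Multiset.cons_inj_right] at h1 h2
      have := r.add (r.refl {z2}) (ih m1 h1 h2)
      simpa using this
    · have hz2' : z2 ∈ m1 := by
        rcases Multiset.mem_cons.1 hz2 with h | h
        · exact absurd h h12
        · exact h
      obtain ⟨m2, rfl⟩ := Multiset.exists_cons_of_mem hz2'
      obtain ⟨w, w1, w2⟩ := hsurj (pL z2) (pR z1) (by
        rw [hτ, e2, ← hτ, ← e1, hτ])
      have hq : r ({z, w} : Multiset Z) {z1, z2} := by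
        apply hr
        · simp
        · simp
        · simp [w1, e1]
        · simp only [Multiset.insert_eq_cons, Multiset.map_cons, Multiset.map_singleton, w2, e2]
          exact Multiset.cons_swap _ _ _
      have h3 := r.add hq (r.refl m2)
      have h4 := ih (w ::ₘ m2) (by
          simp only [Multiset.map_cons, e1, w1] at h1 ⊢
          simpa using h1) (by
          simp only [Multiset.map_cons, e2, w2] at h2 ⊢
          rw [Multiset.cons_swap] at h2
          simpa using h2)
      have h5 := r.add (r.refl {z}) h4
      rw [Multiset.singleton_add, Multiset.singleton_add] at h5
      rw [Multiset.insert_eq_cons, Multiset.insert_eq_cons, Multiset.cons_add, Multiset.cons_add,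
        Multiset.singleton_add, Multiset.singleton_add] at h3
      exact r.trans h5 h3

theorem lift_left
    (hτ : ∀ z, tX (pL z) = tY (pR z))
    (hsurj : ∀ x y, tX x = tY y → ∃ z, pL z = x ∧ pR z = y)
    (kX : AddCon (Multiset X)) (D : ℕ)
    (r : AddCon (Multiset Z))
    (hr : ∀ p q : Multiset Z, p.card ≤ D → q.card ≤ D → kX (p.map pL) (q.map pL) →
      p.map pR = q.map pR → r p q)
    (hX : ∀ s : AddCon (Multiset X), (∀ p q : Multiset X, p.card ≤ D → q.card ≤ D → kX p q →
      p.map tX = q.map tX → s p q) → ∀ p q, kX p q → p.map tX = q.map tX → s p q)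
    (m : Multiset Z) (l : Multiset X) (h1 : kX (m.map pL) l) (h2 : (m.map pL).map tX = l.map tX) :
    ∃ m', m'.map pL = l ∧ m'.map pR = m.map pR ∧ r m m' := by
  let Q : Multiset X → Multiset X → Prop := fun l l' =>
    ∀ m : Multiset Z, m.map pL = l → ∃ m', m'.map pL = l' ∧ m'.map pR = m.map pR ∧ r m m'
  have Qrefl : ∀ l, Q l l := fun l m h => ⟨m, h, rfl, r.refl m⟩
  have Qtrans : ∀ a b c, Q a b → Q b c → Q a c := by
    intro a b c hab hbc m hm
    obtain ⟨m1, e1, e2, e3⟩ := hab m hm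
    obtain ⟨m2, f1, f2, f3⟩ := hbc m1 e1
    exact ⟨m2, f1, f2.trans e2, r.trans e3 f3⟩
  have Qadd : ∀ a b c d, Q a b → Q c d → Q (a + c) (b + d) := by
    intro a b c d hab hcd m hm
    obtain ⟨m1, m2, rfl, e1, e2⟩ := ms_map_eq_add pL m a c hm
    obtain ⟨n1, f1, f2, f3⟩ := hab m1 e1
    obtain ⟨n2, g1, g2, g3⟩ := hcd m2 e2
    exact ⟨n1 + n2, by simp [f1, g1], by simp [f2, g2], r.add f3 g3⟩
  let s : AddCon (Multiset X) :=
    { r := fun l l' => Q l l' ∧ Q l' l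
      iseqv := ⟨fun l => ⟨Qrefl l, Qrefl l⟩, fun h => ⟨h.2, h.1⟩,
        fun h h' => ⟨Qtrans _ _ _ h.1 h'.1, Qtrans _ _ _ h'.2 h.2⟩⟩
      add' := fun h h' => ⟨Qadd _ _ _ _ h.1 h'.1, Qadd _ _ _ _ h.2 h'.2⟩ }
  have base : ∀ p q : Multiset X, p.card ≤ D → q.card ≤ D → kX p q →
      p.map tX = q.map tX → Q p q := by
    intro p q hp hq hk ht m hm
    obtain ⟨m', e1, e2⟩ := pair_exists pL pR tX tY hsurj q (m.map pR) (by
      rw [← ht, ← hm]; simp [hτ])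
    refine ⟨m', e1, e2, hr _ _ ?_ ?_ ?_ e2.symm⟩
    · rw [← Multiset.card_map pL, hm]; exact hp
    · rw [← Multiset.card_map pL, e1]; exact hq
    · rw [hm, e1]; exact hk
  have := hX s (fun p q hp hq hk ht => ⟨base p q hp hq hk ht, base q p hq hp (kX.symm hk) ht.symm⟩)
    _ _ h1 h2
  exact this.1 m rfl

theorem same_height
    (hτ : ∀ z, tX (pL z) = tY (pR z))
    (hinj : ∀ z z', pL z = pL z' → pR z = pR z' → z = z')
    (hsurj : ∀ x y, tX x = tY y → ∃ z, pL z = x ∧ pR z = y)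
    (kX : AddCon (Multiset X)) (kY : AddCon (Multiset Y)) (D : ℕ) (hD : 2 ≤ D)
    (r : AddCon (Multiset Z))
    (hr : ∀ p q : Multiset Z, p.card ≤ D → q.card ≤ D → kX (p.map pL) (q.map pL) →
      kY (p.map pR) (q.map pR) → r p q)
    (hX : ∀ s : AddCon (Multiset X), (∀ p q : Multiset X, p.card ≤ D → q.card ≤ D → kX p q →
      p.map tX = q.map tX → s p q) → ∀ p q, kX p q → p.map tX = q.map tX → s p q)
    (hY : ∀ s : AddCon (Multiset Y), (∀ p q : Multiset Y, p.card ≤ D → q.card ≤ D → kY p q →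
      p.map tY = q.map tY → s p q) → ∀ p q, kY p q → p.map tY = q.map tY → s p q)
    (m m' : Multiset Z) (h1 : kX (m.map pL) (m'.map pL)) (h2 : kY (m.map pR) (m'.map pR))
    (h3 : (m.map pL).map tX = (m'.map pL).map tX) : r m m' := by
  obtain ⟨m1, a1, a2, a3⟩ := lift_left pL pR tX tY hτ hsurj kX D r
    (fun p q hp hq hk he => hr p q hp hq hk (by rw [he]; exact kY.refl _)) hX m _ h1 h3
  obtain ⟨m2, b1, b2, b3⟩ := lift_left pR pL tY tX (fun z => (hτ z).symm)
    (fun y x h => by obtain ⟨z, hz⟩ := hsurj x y h.symm; exact ⟨z, hz.2, hz.1⟩) kY D r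
    (fun p q hp hq hk he => hr p q hp hq (by rw [he]; exact kX.refl _) hk) hY m1 (m'.map pR)
    (by rw [a2]; exact h2) (by
      rw [a2]
      have e : ∀ n : Multiset Z, (n.map pR).map tY = (n.map pL).map tX := by
        intro n; simp [hτ]
      rw [e, e, h3])
  refine r.trans a3 (r.trans b3 ?_)
  refine quad_connected pL pR tX tY hτ hinj hsurj r ?_ m2 m' (b2.trans a1) b1
  intro p q hp hq e1 e2
  exact hr p q (hp.trans hD) (hq.trans hD) (by rw [e1]; exact kX.refl _)
    (by rw [e2]; exact kY.refl _)

theorem raise_height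
    (hτ : ∀ z, tX (pL z) = tY (pR z))
    (hinj : ∀ z z', pL z = pL z' → pR z = pR z' → z = z')
    (hsurj : ∀ x y, tX x = tY y → ∃ z, pL z = x ∧ pR z = y)
    (kX : AddCon (Multiset X)) (kY : AddCon (Multiset Y)) (c d D : ℕ) (hD : 2 ≤ D)
    (hcD : 2 * c - 2 ≤ D) (hdD : 2 * d - 2 ≤ D)
    (r : AddCon (Multiset Z))
    (hr : ∀ p q : Multiset Z, p.card ≤ D → q.card ≤ D → kX (p.map pL) (q.map pL) →
      kY (p.map pR) (q.map pR) → r p q)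
    (hX : ∀ s : AddCon (Multiset X), (∀ p q : Multiset X, p.card ≤ D → q.card ≤ D → kX p q →
      p.map tX = q.map tX → s p q) → ∀ p q, kX p q → p.map tX = q.map tX → s p q)
    (hY : ∀ s : AddCon (Multiset Y), (∀ p q : Multiset Y, p.card ≤ D → q.card ≤ D → kY p q →
      p.map tY = q.map tY → s p q) → ∀ p q, kY p q → p.map tY = q.map tY → s p q)
    (sX : ∀ l l' : Multiset X, kX l l' → (l.map tX).count true < (l'.map tX).count true →
      ∃ l0 x x', kX l (l0 + x) ∧ (l0 + x).map tX = l.map tX ∧ kX x x' ∧ x.card ≤ c ∧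
        x'.card = x.card ∧ (x'.map tX).count true = (x.map tX).count true + 2)
    (sY : ∀ l l' : Multiset Y, kY l l' → (l.map tY).count true < (l'.map tY).count true →
      ∃ l0 x x', kY l (l0 + x) ∧ (l0 + x).map tY = l.map tY ∧ kY x x' ∧ x.card ≤ d ∧
        x'.card = x.card ∧ (x'.map tY).count true = (x.map tY).count true + 2)
    (m m' : Multiset Z) (h1 : kX (m.map pL) (m'.map pL)) (h2 : kY (m.map pR) (m'.map pR))
    (h3 : ((m.map pL).map tX).count true < ((m'.map pL).map tX).count true) :
    ∃ m'', r m m'' ∧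
      ((m''.map pL).map tX).count true = ((m.map pL).map tX).count true + 2 := by
  classical
  have e : ∀ n : Multiset Z, (n.map pR).map tY = (n.map pL).map tX := by
    intro n; simp [hτ]
  obtain ⟨l0, x, x', a1, a2, a3, a4, a5, a6⟩ := sX _ _ h1 h3
  obtain ⟨r0, y, y', b1, b2, b3, b4, b5, b6⟩ := sY _ _ h2 (by rw [e, e]; exact h3)
  have hxy : l0.map tX + x.map tX = r0.map tY + y.map tY := by
    rw [← Multiset.map_add, ← Multiset.map_add, a2, b2, e]
  obtain ⟨ex, l1, rfl, hex⟩ := ms_le_map tX l0 (y.map tY - x.map tX) (by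
    rw [tsub_le_iff_right, hxy]; exact Multiset.le_add_left _ _)
  obtain ⟨ey, r1, rfl, hey⟩ := ms_le_map tY r0 (x.map tX - y.map tY) (by
    rw [tsub_le_iff_right, ← hxy]; exact Multiset.le_add_left _ _)
  have hu : (x + ex).map tX = (y + ey).map tY := by
    rw [Multiset.map_add, Multiset.map_add, hex, hey]
    ext b
    simp only [Multiset.count_add, Multiset.count_sub]
    omega
  have hl1 : l1.map tX = r1.map tY := by
    simp only [Multiset.map_add] at hxy hu
    have : l1.map tX + (x.map tX + ex.map tX) = r1.map tY + (x.map tX + ex.map tX) := by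
      conv_rhs => rw [hu]
      rw [show l1.map tX + (x.map tX + ex.map tX) = ex.map tX + l1.map tX + x.map tX by abel, hxy]
      abel
    exact add_right_cancel this
  have cx := ms_bool_card (x.map tX)
  have cy := ms_bool_card (y.map tY)
  have cx' := ms_bool_card (x'.map tX)
  have cy' := ms_bool_card (y'.map tY)
  simp only [Multiset.card_map] at cx cy cx' cy'
  have cex := ms_bool_card (ex.map tX)
  have cey := ms_bool_card (ey.map tY)
  have hu' : (x' + ex).map tX = (y' + ey).map tY := by
    rw [Multiset.map_add, Multiset.map_add]
    have ht := congrArg (Multiset.count true) hu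
    have hf := congrArg (Multiset.count false) hu
    simp only [Multiset.map_add, Multiset.count_add] at ht hf
    ext b
    cases b <;> simp only [Multiset.count_add] <;> omega
  have hcard : (x + ex).card ≤ D := by
    rw [hex] at cex
    simp only [Multiset.count_sub] at cex
    rw [Multiset.card_add, ← Multiset.card_map tX ex, hex]
    omega
  obtain ⟨z0, c1, c2⟩ := pair_exists pL pR tX tY hsurj _ _ hl1
  obtain ⟨z1, d1, d2⟩ := pair_exists pL pR tX tY hsurj _ _ hu
  obtain ⟨z2, f1, f2⟩ := pair_exists pL pR tX tY hsurj _ _ hu'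
  refine ⟨z0 + z2, r.trans (y := z0 + z1) ?_ (r.add (r.refl _) ?_), ?_⟩
  · refine same_height pL pR tX tY hτ hinj hsurj kX kY D hD r hr hX hY _ _ ?_ ?_ ?_
    · rw [Multiset.map_add, c1, d1]
      rwa [show l1 + (x + ex) = ex + l1 + x by abel]
    · rw [Multiset.map_add, c2, d2]
      rwa [show r1 + (y + ey) = ey + r1 + y by abel]
    · rw [Multiset.map_add, c1, d1, ← a2]
      rw [show l1 + (x + ex) = ex + l1 + x by abel]
  · apply hr
    · rw [← Multiset.card_map pL, d1]; exact hcard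
    · rw [← Multiset.card_map pL, f1]
      rw [Multiset.card_add] at *
      omega
    · rw [d1, f1]; exact kX.add a3 (kX.refl _)
    · rw [d2, f2]; exact kY.add b3 (kY.refl _)
  · rw [← a2, Multiset.map_add, c1, f1]
    simp only [Multiset.map_add, Multiset.count_add]
    omega

theorem all_connected
    (hτ : ∀ z, tX (pL z) = tY (pR z))
    (hinj : ∀ z z', pL z = pL z' → pR z = pR z' → z = z')
    (hsurj : ∀ x y, tX x = tY y → ∃ z, pL z = x ∧ pR z = y)
    (kX : AddCon (Multiset X)) (kY : AddCon (Multiset Y)) (c d D : ℕ) (hD : 2 ≤ D)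
    (hcD : 2 * c - 2 ≤ D) (hdD : 2 * d - 2 ≤ D)
    (r : AddCon (Multiset Z))
    (hr : ∀ p q : Multiset Z, p.card ≤ D → q.card ≤ D → kX (p.map pL) (q.map pL) →
      kY (p.map pR) (q.map pR) → r p q)
    (hr' : ∀ p q : Multiset Z, r p q → kX (p.map pL) (q.map pL) ∧ kY (p.map pR) (q.map pR))
    (hX : ∀ s : AddCon (Multiset X), (∀ p q : Multiset X, p.card ≤ D → q.card ≤ D → kX p q →
      p.map tX = q.map tX → s p q) → ∀ p q, kX p q → p.map tX = q.map tX → s p q)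
    (hY : ∀ s : AddCon (Multiset Y), (∀ p q : Multiset Y, p.card ≤ D → q.card ≤ D → kY p q →
      p.map tY = q.map tY → s p q) → ∀ p q, kY p q → p.map tY = q.map tY → s p q)
    (sX : ∀ l l' : Multiset X, kX l l' → (l.map tX).count true < (l'.map tX).count true →
      ∃ l0 x x', kX l (l0 + x) ∧ (l0 + x).map tX = l.map tX ∧ kX x x' ∧ x.card ≤ c ∧
        x'.card = x.card ∧ (x'.map tX).count true = (x.map tX).count true + 2)
    (sY : ∀ l l' : Multiset Y, kY l l' → (l.map tY).count true < (l'.map tY).count true →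
      ∃ l0 x x', kY l (l0 + x) ∧ (l0 + x).map tY = l.map tY ∧ kY x x' ∧ x.card ≤ d ∧
        x'.card = x.card ∧ (x'.map tY).count true = (x.map tY).count true + 2)
    (hcX : ∀ p q, kX p q → p.card = q.card)
    (hpar : ∀ p q, kX p q → (p.map tX).count true % 2 = (q.map tX).count true % 2)
    (m m' : Multiset Z) (h1 : kX (m.map pL) (m'.map pL)) (h2 : kY (m.map pR) (m'.map pR)) :
    r m m' := by
  have main : ∀ n : ℕ, ∀ m m' : Multiset Z, kX (m.map pL) (m'.map pL) →
      kY (m.map pR) (m'.map pR) →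
      ((m'.map pL).map tX).count true = ((m.map pL).map tX).count true + n → r m m' := by
    intro n
    induction n using Nat.strong_induction_on with
    | _ n ih =>
      intro m m' h1 h2 h3
      rcases Nat.eq_zero_or_pos n with rfl | hn
      · refine same_height pL pR tX tY hτ hinj hsurj kX kY D hD r hr hX hY _ _ h1 h2 ?_
        apply ms_bool_ext
        · simpa using hcX _ _ h1
        · simpa using h3.symm
      · obtain ⟨m1, a1, a2⟩ := raise_height pL pR tX tY hτ hinj hsurj kX kY c d D hD hcD hdD r hr
          hX hY sX sY m m' h1 h2 (by omega)
        have hp := hpar _ _ h1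
        have := hr' _ _ a1
        refine r.trans a1 (ih (n - 2) (by omega) _ _ (kX.trans (kX.symm this.1) h1)
          (kY.trans (kY.symm this.2) h2) (by omega))
  rcases le_total (((m.map pL).map tX).count true) (((m'.map pL).map tX).count true) with h | h
  · exact main _ m m' h1 h2 (Nat.add_sub_cancel' h).symm
  · exact r.symm (main _ m' m (kX.symm h1) (kY.symm h2) (Nat.add_sub_cancel' h).symm)

end Comb

section Cross

theorem crossing {X : Type*} (tX : X → Bool) (kX : AddCon (Multiset X)) (c : ℕ)
    (P : Set (Multiset X × Multiset X))
    (hP : ∀ p ∈ P, kX p.1 p.2)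
    (hPc : ∀ p ∈ P, p.1.card ≤ c ∧ p.2.card ≤ c)
    (hPs : ∀ p ∈ P, ((((p.1.map tX).count true : ℕ) : ℤ) -
      (((p.2.map tX).count true : ℕ) : ℤ)).natAbs ≤ 2)
    (hgen : ∀ s : AddCon (Multiset X), (∀ p ∈ P, s p.1 p.2) → ∀ p q, kX p q → s p q)
    (hcX : ∀ p q, kX p q → p.card = q.card)
    (hpar : ∀ p q, kX p q → (p.map tX).count true % 2 = (q.map tX).count true % 2)
    (l l' : Multiset X) (hk : kX l l') (hlt : (l.map tX).count true < (l'.map tX).count true) :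
      ∃ l0 x x', kX l (l0 + x) ∧ (l0 + x).map tX = l.map tX ∧ kX x x' ∧ x.card ≤ c ∧
        x'.card = x.card ∧ (x'.map tX).count true = (x.map tX).count true + 2 := by
  let step : Multiset X → Multiset X → Prop := fun l l' =>
    ∃ r x x', l = r + x ∧ l' = r + x' ∧ ((x, x') ∈ P ∨ (x', x) ∈ P)
  have step_symm : ∀ a b, step a b → step b a := by
    rintro a b ⟨r, x, x', h1, h2, h3⟩
    exact ⟨r, x', x, h2, h1, h3.symm⟩
  have step_add : ∀ a b e, step a b → step (a + e) (b + e) := by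
    rintro a b e ⟨r, x, x', h1, h2, h3⟩
    exact ⟨r + e, x, x', by rw [h1]; abel, by rw [h2]; abel, h3⟩
  have T_add : ∀ a b e, Relation.ReflTransGen step a b →
      Relation.ReflTransGen step (a + e) (b + e) := by
    intro a b e h
    induction h with
    | refl => exact Relation.ReflTransGen.refl
    | tail _ h2 ih => exact ih.tail (step_add _ _ e h2)
  have T_symm : ∀ a b, Relation.ReflTransGen step a b → Relation.ReflTransGen step b a := by
    intro a b h
    induction h with
    | refl => exact Relation.ReflTransGen.refl
    | tail _ h2 ih => exact Relation.ReflTransGen.head (step_symm _ _ h2) ih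
  let s : AddCon (Multiset X) :=
    { r := Relation.ReflTransGen step
      iseqv := ⟨fun _ => Relation.ReflTransGen.refl,
        fun h => T_symm _ _ h,
        fun h h' => Relation.ReflTransGen.trans h h'⟩
      add' := by
        intro w x y z h h'
        have h1 := T_add _ _ y h
        have h2 := T_add _ _ x h'
        rw [add_comm y, add_comm z] at h2
        exact h1.trans h2 }
  have hpath : Relation.ReflTransGen step l l' := hgen s (by
    intro p hp
    exact Relation.ReflTransGen.single ⟨0, p.1, p.2, by simp, by simp, Or.inl hp⟩) l l' hk
  have key : ∀ k, Relation.ReflTransGen step l k → kX l k ∧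
      ((k.map tX).count true ≤ (l.map tX).count true ∨
      ∃ l0 x x', kX l (l0 + x) ∧ (l0 + x).map tX = l.map tX ∧ kX x x' ∧ x.card ≤ c ∧
        x'.card = x.card ∧ (x'.map tX).count true = (x.map tX).count true + 2) := by
    intro k h
    induction h with
    | refl => exact ⟨kX.refl _, Or.inl le_rfl⟩
    | tail h1 h2 ih =>
      obtain ⟨r, x, x', rfl, rfl, h3⟩ := h2
      have hxx : kX x x' := by
        rcases h3 with h3 | h3
        · exact hP _ h3
        · exact kX.symm (hP _ h3)
      have hxc : x.card ≤ c := by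
        rcases h3 with h3 | h3
        · exact (hPc _ h3).1
        · exact (hPc _ h3).2
      have hs : ((((x.map tX).count true : ℕ) : ℤ) -
          (((x'.map tX).count true : ℕ) : ℤ)).natAbs ≤ 2 := by
        rcases h3 with h3 | h3
        · exact hPs _ h3
        · have := hPs _ h3
          simp only at this
          omega
      have hk2 : kX l (r + x') := kX.trans ih.1 (kX.add (kX.refl r) hxx)
      refine ⟨hk2, ?_⟩
      rcases ih.2 with hle | hex
      · by_cases hle' : ((r + x').map tX).count true ≤ (l.map tX).count true
        · exact Or.inl hle'
        · right
          have p1 := hpar _ _ ih.1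
          have p2 := hpar _ _ hk2
          simp only [Multiset.map_add, Multiset.count_add] at *
          refine ⟨r, x, x', ih.1, ?_, hxx, hxc, (hcX _ _ hxx).symm, by omega⟩
          rw [← Multiset.map_add]
          apply ms_bool_ext
          · simpa using (hcX _ _ ih.1).symm
          · simp only [Multiset.map_add, Multiset.count_add]
            omega
      · exact Or.inr hex
  rcases (key l' hpath).2 with h | h
  · omega
  · exact h

end Cross
section Alg

theorem mon_eq (K : Type) [Field K] {V : Type} [DecidableEq V] {v₀ : V}
    (m : Multiset {A : Finset V // v₀ ∈ A}) :
    mon K m = monomial (Multiset.toFinsupp m) 1 := by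
  induction m using Multiset.induction_on with
  | empty => simp [mon]
  | cons a m ih =>
    have h : mon K (a ::ₘ m) = X a * mon K m := by simp [mon]
    rw [h, ih, ← Multiset.singleton_add, Multiset.toFinsupp_add, Multiset.toFinsupp_singleton, X,
      monomial_mul, one_mul]

theorem monomial_eq_mon (K : Type) [Field K] {V : Type} [DecidableEq V] {v₀ : V}
    (p : {A : Finset V // v₀ ∈ A} →₀ ℕ) :
    (monomial p (1 : K)) = mon K (Finsupp.toMultiset p) := by
  rw [mon_eq]; simp

theorem mon_add (K : Type) [Field K] {V : Type} {v₀ : V}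
    (m n : Multiset {A : Finset V // v₀ ∈ A}) : mon K (m + n) = mon K m * mon K n := by
  simp [mon]

/-- The exponent vector of the image of a variable. -/
def wt {V : Type} [Fintype V] [DecidableEq V] (H : SimpleGraph V) (v₀ : V)
    (A : {A : Finset V // v₀ ∈ A}) : Sym2 V × Bool →₀ ℕ :=
  ∑ e ∈ (Set.toFinite H.edgeSet).toFinset, Finsupp.single (e, sep A.1 e) 1

/-- The exponent vector of the image of a monomial. -/
def wts {V : Type} [Fintype V] [DecidableEq V] (H : SimpleGraph V) (v₀ : V)
    (m : Multiset {A : Finset V // v₀ ∈ A}) : Sym2 V × Bool →₀ ℕ :=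
  (m.map (wt H v₀)).sum

theorem cutMap_X (K : Type) [Field K] {V : Type} [Fintype V] [DecidableEq V]
    (H : SimpleGraph V) (v₀ : V) (A : {A : Finset V // v₀ ∈ A}) :
    cutMap K H v₀ (X A) = monomial (wt H v₀ A) 1 := by
  rw [cutMap, aeval_X, wt, monomial_sum_one]
  rfl

theorem cutMap_mon (K : Type) [Field K] {V : Type} [Fintype V] [DecidableEq V]
    (H : SimpleGraph V) (v₀ : V) (m : Multiset {A : Finset V // v₀ ∈ A}) :
    cutMap K H v₀ (mon K m) = monomial (wts H v₀ m) 1 := by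
  induction m using Multiset.induction_on with
  | empty => simp [mon, wts]
  | cons a m ih =>
    have h : mon K (a ::ₘ m) = X a * mon K m := by simp [mon]
    rw [h, map_mul, ih, cutMap_X, monomial_mul, one_mul]
    simp [wts]

/-- Two monomials lie in the same fiber of the cut map. -/
def fib {V : Type} [DecidableEq V] (H : SimpleGraph V) (v₀ : V) :
    AddCon (Multiset {A : Finset V // v₀ ∈ A}) where
  r p q := ∀ x y, H.Adj x y →
    p.map (fun A => sep A.1 s(x, y)) = q.map (fun A => sep A.1 s(x, y))
  iseqv := ⟨fun _ _ _ _ => rfl, fun h x y hxy => (h x y hxy).symm,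
    fun h h' x y hxy => (h x y hxy).trans (h' x y hxy)⟩
  add' := by
    intro a b c d h h' x y hxy
    rw [Multiset.map_add, Multiset.map_add, h x y hxy, h' x y hxy]

theorem fib_iff {V : Type} [DecidableEq V] (H : SimpleGraph V) (v₀ : V)
    (p q : Multiset {A : Finset V // v₀ ∈ A}) : fib H v₀ p q ↔ ∀ x y, H.Adj x y →
    p.map (fun A => sep A.1 s(x, y)) = q.map (fun A => sep A.1 s(x, y)) := Iff.rfl

theorem wts_apply {V : Type} [Fintype V] [DecidableEq V] (H : SimpleGraph V) (v₀ : V)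
    (m : Multiset {A : Finset V // v₀ ∈ A}) (e : Sym2 V) (b : Bool) [Decidable (e ∈ H.edgeSet)] :
    wts H v₀ m (e, b) =
      if e ∈ H.edgeSet then (m.map (fun A => sep A.1 e)).count b else 0 := by
  induction m using Multiset.induction_on with
  | empty => simp [wts]
  | cons a m ih =>
    have h : wts H v₀ (a ::ₘ m) = wt H v₀ a + wts H v₀ m := by simp [wts]
    rw [h, Finsupp.add_apply, ih]
    have h2 : wt H v₀ a (e, b) = if e ∈ H.edgeSet then (if b = sep a.1 e then 1 else 0) else 0 := by
      rw [wt, Finsupp.finsetSum_apply]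
      split_ifs with h1 h2
      · rw [Finset.sum_eq_single e]
        · simp [h2]
        · intro e' _ hne
          simp [Finsupp.single_apply, hne]
        · intro hh; simp at hh; exact absurd h1 hh
      · apply Finset.sum_eq_zero
        intro e' _
        rw [Finsupp.single_apply, if_neg]
        rintro h3
        rw [Prod.mk.injEq] at h3
        obtain ⟨rfl, h4⟩ := h3
        exact h2 h4.symm
      · apply Finset.sum_eq_zero
        intro e' he'
        rw [Finsupp.single_apply, if_neg]
        rintro h3
        rw [Prod.mk.injEq] at h3
        obtain ⟨rfl, h4⟩ := h3
        simp at he'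
        exact h1 he'
    rw [h2]
    split_ifs <;> simp_all [Multiset.count_cons]
    all_goals omega

theorem wts_eq_iff {V : Type} [Fintype V] [DecidableEq V] (H : SimpleGraph V) (v₀ : V)
    (p q : Multiset {A : Finset V // v₀ ∈ A}) : wts H v₀ p = wts H v₀ q ↔ fib H v₀ p q := by
  classical
  rw [fib_iff]
  constructor
  · intro h x y hxy
    ext b
    have := DFunLike.congr_fun h (s(x, y), b)
    rw [wts_apply, wts_apply, if_pos (by simpa using hxy), if_pos (by simpa using hxy)] at this
    exact this
  · intro h
    ext ⟨e, b⟩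
    rw [wts_apply, wts_apply]
    split_ifs with he
    · induction e with
      | _ x y => rw [h x y (by simpa using he)]
    · rfl

theorem cutMap_mon_eq_iff (K : Type) [Field K] {V : Type} [Fintype V] [DecidableEq V]
    (H : SimpleGraph V) (v₀ : V) (p q : Multiset {A : Finset V // v₀ ∈ A}) :
    mon K p - mon K q ∈ cutIdeal K H v₀ ↔ fib H v₀ p q := by
  rw [cutIdeal, RingHom.mem_ker, map_sub, cutMap_mon, cutMap_mon, sub_eq_zero, ← wts_eq_iff]
  constructor
  · intro h
    exact monomial_left_injective (one_ne_zero) h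
  · intro h; rw [h]

theorem core (K : Type) [Field K] {V : Type} [Fintype V] [DecidableEq V]
    (H : SimpleGraph V) (v₀ : V) {N : Type*} [CommRing N] [Algebra K N]
    (ψ : MvPolynomial {A : Finset V // v₀ ∈ A} K →ₐ[K] N)
    (f : MvPolynomial {A : Finset V // v₀ ∈ A} K) (hf : f ∈ cutIdeal K H v₀)
    (h : ∀ p ∈ f.support, ∀ q ∈ f.support,
      fib H v₀ (Finsupp.toMultiset p) (Finsupp.toMultiset q) →
      ψ (mon K (Finsupp.toMultiset p)) = ψ (mon K (Finsupp.toMultiset q))) : ψ f = 0 := by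
  classical
  let g : (Sym2 V × Bool →₀ ℕ) → N := fun β =>
    if hβ : ∃ p ∈ f.support, wts H v₀ (Finsupp.toMultiset p) = β then
      ψ (mon K (Finsupp.toMultiset hβ.choose)) else 0
  have hg : ∀ p ∈ f.support,
      g (wts H v₀ (Finsupp.toMultiset p)) = ψ (mon K (Finsupp.toMultiset p)) := by
    intro p hp
    have hβ : ∃ p' ∈ f.support,
      wts H v₀ (Finsupp.toMultiset p') = wts H v₀ (Finsupp.toMultiset p) := ⟨p, hp, rfl⟩
    simp only [g]
    rw [dif_pos hβ]
    exact h _ hβ.choose_spec.1 _ hp ((wts_eq_iff _ _ _ _).1 hβ.choose_spec.2)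
  let Λ := (basisMonomials (Sym2 V × Bool) K).constr K g
  have hΛ : ∀ β, Λ (monomial β 1) = g β := by
    intro β
    have := (basisMonomials (Sym2 V × Bool) K).constr_basis K g β
    rwa [coe_basisMonomials] at this
  have hfs : f = ∑ p ∈ f.support, coeff p f • mon K (Finsupp.toMultiset p) := by
    conv_lhs => rw [f.as_sum]
    refine Finset.sum_congr rfl fun p _ => ?_
    rw [← monomial_eq_mon, smul_monomial, smul_eq_mul, mul_one]
  have h0 : Λ (cutMap K H v₀ f) = 0 := by
    have : cutMap K H v₀ f = 0 := hf
    rw [this, map_zero]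
  have e1 : Λ (cutMap K H v₀ f) = ∑ p ∈ f.support, coeff p f • ψ (mon K (Finsupp.toMultiset p)) := by
    conv_lhs => rw [hfs]
    rw [map_sum, map_sum]
    refine Finset.sum_congr rfl fun p hp => ?_
    rw [map_smul, map_smul, cutMap_mon, hΛ, hg p hp]
  have e2 : ψ f = ∑ p ∈ f.support, coeff p f • ψ (mon K (Finsupp.toMultiset p)) := by
    conv_lhs => rw [hfs]
    rw [map_sum]
    refine Finset.sum_congr rfl fun p hp => ?_
    rw [map_smul]
  rw [e2, ← e1, h0]

theorem span_connected (K : Type) [Field K] {V : Type} [Fintype V] [DecidableEq V]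
    (H : SimpleGraph V) (v₀ : V) (S : Set (MvPolynomial {A : Finset V // v₀ ∈ A} K))
    (hS : Ideal.span S = cutIdeal K H v₀)
    (s : AddCon (Multiset {A : Finset V // v₀ ∈ A}))
    (hs : ∀ f ∈ S, ∀ p ∈ f.support, ∀ q ∈ f.support,
      fib H v₀ (Finsupp.toMultiset p) (Finsupp.toMultiset q) →
      s (Finsupp.toMultiset p) (Finsupp.toMultiset q))
    (p q : Multiset {A : Finset V // v₀ ∈ A}) (hpq : fib H v₀ p q) : s p q := by
  classical
  let ψ : MvPolynomial {A : Finset V // v₀ ∈ A} K →ₐ[K] AddMonoidAlgebra K s.Quotient :=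
    aeval fun A => AddMonoidAlgebra.single (({A} : Multiset _) : s.Quotient) 1
  have hψ : ∀ m, ψ (mon K m) = AddMonoidAlgebra.single (m : s.Quotient) 1 := by
    intro m
    induction m using Multiset.induction_on with
    | empty =>
      simp only [mon, Multiset.map_zero, Multiset.prod_zero, map_one]
      rfl
    | cons a m ih =>
      have h : mon K (a ::ₘ m) = X a * mon K m := by simp [mon]
      rw [h, map_mul, ih, aeval_X, AddMonoidAlgebra.single_mul_single, one_mul,
        ← Multiset.singleton_add, AddCon.coe_add]
  have hle : Ideal.span S ≤ RingHom.ker ψ := by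
    rw [Ideal.span_le]
    intro f hf
    refine core K H v₀ ψ f (hS ▸ Ideal.subset_span hf) ?_
    intro p hp q hq hh
    rw [hψ, hψ, (s.eq).2 (hs f hf p hp q hq hh)]
  have hmem : mon K p - mon K q ∈ RingHom.ker ψ := by
    apply hle; rw [hS]; exact (cutMap_mon_eq_iff K H v₀ p q).2 hpq
  rw [RingHom.mem_ker, map_sub, sub_eq_zero, hψ, hψ] at hmem
  have := AddMonoidAlgebra.single_left_injective (one_ne_zero) hmem
  exact (s.eq).1 this

/-- The congruence of binomials in an ideal. -/
def idealCon (K : Type) [Field K] {V : Type} {v₀ : V}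
    (J : Ideal (MvPolynomial {A : Finset V // v₀ ∈ A} K)) :
    AddCon (Multiset {A : Finset V // v₀ ∈ A}) where
  r p q := mon K p - mon K q ∈ J
  iseqv := ⟨fun p => by simp, fun {p q} h => by simpa using J.neg_mem h,
    fun {p q r} h h' => by simpa using J.add_mem h h'⟩
  add' := by
    intro a b c d h h'
    have e : mon K (a + c) - mon K (b + d) =
        mon K a * (mon K c - mon K d) + mon K d * (mon K a - mon K b) := by
      rw [mon_add, mon_add]; ring
    rw [e]
    exact J.add_mem (J.mul_mem_left _ h') (J.mul_mem_left _ h)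

theorem connected_span (K : Type) [Field K] {V : Type} [Fintype V] [DecidableEq V]
    (H : SimpleGraph V) (v₀ : V) (J : Ideal (MvPolynomial {A : Finset V // v₀ ∈ A} K))
    (hJ : ∀ p q, fib H v₀ p q → mon K p - mon K q ∈ J) : cutIdeal K H v₀ ≤ J := by
  intro f hf
  have := core K H v₀ (Ideal.Quotient.mkₐ K J) f hf (by
    intro p _ q _ h
    exact Ideal.Quotient.eq.2 (hJ _ _ h))
  exact Ideal.Quotient.eq_zero_iff_mem.1 this

end Alg

section Side

set_option linter.unusedSectionVars false

variable {V : Type} [Fintype V] [DecidableEq V]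

theorem sep_mk (A : Finset V) (x y : V) :
    sep A s(x, y) = (decide (x ∈ A)).xor (decide (y ∈ A)) := rfl

theorem height_eq (u v : V) {v₀ : V} (m : Multiset {A : Finset V // v₀ ∈ A}) :
    height u v m = (m.map fun A => sep A.1 s(u, v)).count true := by
  rw [height, Multiset.count_map]
  congr 1
  apply Multiset.filter_congr
  intro A _
  exact eq_comm

theorem fib_card (H : SimpleGraph V) (v₀ x y : V) (hxy : H.Adj x y)
    (p q : Multiset {A : Finset V // v₀ ∈ A}) (h : fib H v₀ p q) : p.card = q.card := by
  have := congrArg Multiset.card (h x y hxy)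
  simpa using this

theorem fib_parity (H : SimpleGraph V) (v₀ u v : V) (huv : H.Reachable u v)
    (p q : Multiset {A : Finset V // v₀ ∈ A}) (h : fib H v₀ p q) :
    (p.map fun A => sep A.1 s(u, v)).count true % 2 =
      (q.map fun A => sep A.1 s(u, v)).count true % 2 := by
  rw [SimpleGraph.reachable_iff_reflTransGen] at huv
  induction huv with
  | refl =>
    have e : ∀ p : Multiset {A : Finset V // v₀ ∈ A},
        (p.map fun A => sep A.1 s(u, u)).count true = 0 := by
      intro p
      rw [Multiset.count_eq_zero]
      intro hm
      obtain ⟨A, _, hA⟩ := Multiset.mem_map.1 hm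
      simp [sep_mk] at hA
    rw [e, e]
  | @tail x y _ hxy ih =>
    have e : ∀ p : Multiset {A : Finset V // v₀ ∈ A},
        (p.map fun A => sep A.1 s(u, y)).count true % 2 =
          ((p.map fun A => sep A.1 s(u, x)).count true +
            (p.map fun A => sep A.1 s(x, y)).count true) % 2 := by
      intro p
      induction p using Multiset.induction_on with
      | empty => simp
      | cons a p ih =>
        simp only [Multiset.map_cons, Multiset.count_cons, sep_mk] at ih ⊢
        by_cases h1 : u ∈ a.1 <;> by_cases h2 : x ∈ a.1 <;> by_cases h3 : y ∈ a.1 <;>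
          simp [h1, h2, h3] <;> omega
    rw [e, e, h x y hxy]
    omega

theorem fib_addEdge (H : SimpleGraph V) (v₀ u v : V) (huv : u ≠ v)
    (p q : Multiset {A : Finset V // v₀ ∈ A}) :
    fib (addEdge H u v) v₀ p q ↔ fib H v₀ p q ∧
      p.map (fun A => sep A.1 s(u, v)) = q.map (fun A => sep A.1 s(u, v)) := by
  constructor
  · intro h
    refine ⟨fun x y hxy => h x y ?_, h u v ?_⟩
    · simp [addEdge, hxy]
    · simp [addEdge, huv]
  · rintro ⟨h1, h2⟩ x y hxy
    simp only [addEdge, SimpleGraph.sup_adj, SimpleGraph.fromEdgeSet_adj,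
      Set.mem_singleton_iff] at hxy
    rcases hxy with hxy | hxy
    · exact h1 x y hxy
    · rw [hxy.1]; exact h2

theorem side_same (K : Type) [Field K] (H : SimpleGraph V) (u v : V) (huv : u ≠ v) (a : ℕ)
    (ha : ∃ S : Set (MvPolynomial {B : Finset V // u ∈ B} K),
      Ideal.span S = cutIdeal K (addEdge H u v) u ∧ ∀ p ∈ S, p.totalDegree ≤ a)
    (s : AddCon (Multiset {A : Finset V // u ∈ A}))
    (hs : ∀ p q : Multiset {A : Finset V // u ∈ A}, p.card ≤ a → q.card ≤ a → fib H u p q →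
      p.map (fun A => sep A.1 s(u, v)) = q.map (fun A => sep A.1 s(u, v)) → s p q)
    (p q : Multiset {A : Finset V // u ∈ A}) (h1 : fib H u p q)
    (h2 : p.map (fun A => sep A.1 s(u, v)) = q.map (fun A => sep A.1 s(u, v))) : s p q := by
  obtain ⟨S, hS, hd⟩ := ha
  have hc : ∀ f ∈ S, ∀ p ∈ f.support, (Finsupp.toMultiset p).card ≤ a := by
    intro f hf p hp
    rw [Finsupp.card_toMultiset]
    exact (le_totalDegree hp).trans (hd f hf)
  refine span_connected K (addEdge H u v) u S hS s ?_ p q ((fib_addEdge H u u v huv p q).2 ⟨h1, h2⟩)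
  intro f hf p hp q hq hh
  rw [fib_addEdge H u u v huv] at hh
  exact hs _ _ (hc f hf p hp) (hc f hf q hq) hh.1 hh.2

theorem side_cross (K : Type) [Field K] (H : SimpleGraph V) (u v : V)
    (hpath : H.Reachable u v) (c : ℕ)
    (SL : Set (Multiset {B : Finset V // u ∈ B} × Multiset {B : Finset V // u ∈ B}))
    (hSLgen : Ideal.span ((fun p => mon K p.1 - mon K p.2) '' SL) = cutIdeal K H u)
    (hSLslow : ∀ p ∈ SL, ((height u v p.1 : ℤ) - (height u v p.2 : ℤ)).natAbs ≤ 2)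
    (hSLdeg : ∀ p ∈ SL, Multiset.card p.1 ≤ c ∧ Multiset.card p.2 ≤ c)
    (hcX : ∀ p q, fib H u p q → p.card = q.card)
    (l l' : Multiset {A : Finset V // u ∈ A}) (hk : fib H u l l')
    (hlt : (l.map (fun A => sep A.1 s(u, v))).count true <
      (l'.map (fun A => sep A.1 s(u, v))).count true) :
      ∃ l0 x x', fib H u l (l0 + x) ∧ (l0 + x).map (fun A => sep A.1 s(u, v)) =
          l.map (fun A => sep A.1 s(u, v)) ∧ fib H u x x' ∧ x.card ≤ c ∧
        x'.card = x.card ∧ (x'.map (fun A => sep A.1 s(u, v))).count true =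
          (x.map (fun A => sep A.1 s(u, v))).count true + 2 := by
  refine crossing (fun A : {A : Finset V // u ∈ A} => sep A.1 s(u, v)) (fib H u) c SL ?_ hSLdeg ?_
    ?_ hcX (fib_parity H u u v hpath) l l' hk hlt
  · intro p hp
    rw [← cutMap_mon_eq_iff K, ← hSLgen]
    exact Ideal.subset_span ⟨p, hp, rfl⟩
  · intro p hp
    rw [← height_eq, ← height_eq]
    exact hSLslow p hp
  · intro s hs p q hpq
    refine span_connected K H u _ hSLgen s ?_ p q hpq
    rintro f ⟨x, hx, rfl⟩ p hp q hq _
    have hsup : ∀ p ∈ (mon K x.1 - mon K x.2).support,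
        Finsupp.toMultiset p = x.1 ∨ Finsupp.toMultiset p = x.2 := by
      intro p hp
      have := support_sub _ _ _ hp
      rw [Finset.mem_union, mon_eq, mon_eq] at this
      rcases this with h | h
      · left
        rw [Finset.mem_singleton.1 (support_monomial_subset h)]; simp
      · right
        rw [Finset.mem_singleton.1 (support_monomial_subset h)]; simp
    have h12 := hs x hx
    rcases hsup p hp with e | e <;> rcases hsup q hq with e' | e' <;> rw [e, e']
    · exact s.refl _
    · exact h12
    · exact s.symm h12
    · exact s.refl _

theorem side_quad (H : SimpleGraph V) (u v : V) (huv : u ≠ v) (hadj : ¬ H.Adj u v) :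
    ∃ l l' : Multiset {A : Finset V // u ∈ A}, fib H u l l' ∧
    (l.map (fun A => sep A.1 s(u, v))).count true <
      (l'.map (fun A => sep A.1 s(u, v))).count true := by
  refine ⟨{⟨Finset.univ, by simp⟩, ⟨{u, v}, by simp⟩},
    {⟨{u}, by simp⟩, ⟨Finset.univ.erase v, by simp [huv]⟩}, ?_, ?_⟩
  · intro x y hxy
    have hne := hxy.ne
    have hs := hxy.symm
    simp only [Multiset.insert_eq_cons, Multiset.map_cons, Multiset.map_singleton, sep_mk]
    by_cases h1 : x = u <;> by_cases h2 : x = v <;> by_cases h3 : y = u <;> by_cases h4 : y = v <;>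
      simp_all
    all_goals first | decide | exact absurd h1 huv.symm | exact absurd h3 huv.symm
  · simp [sep_mk, huv, huv.symm]

end Side

theorem side_card {V : Type} [Fintype V] [DecidableEq V] (H : SimpleGraph V) (u v : V)
    (huv : u ≠ v) (hpath : H.Reachable u v) (p q : Multiset {A : Finset V // u ∈ A})
    (h : fib H u p q) : p.card = q.card := by
  rw [SimpleGraph.reachable_iff_reflTransGen] at hpath
  rcases Relation.ReflTransGen.cases_head hpath with h0 | ⟨w, hw, _⟩
  · exact absurd h0 huv
  · exact fib_card H u u w hw p q h

theorem totalDegree_mon_le (K : Type) [Field K] {V : Type} [DecidableEq V] {v₀ : V}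
    (m : Multiset {A : Finset V // v₀ ∈ A}) : (mon K m).totalDegree ≤ m.card := by
  rw [mon_eq]
  refine (totalDegree_monomial_le _ _).trans (le_of_eq ?_)
  have := Finsupp.card_toMultiset (Multiset.toFinsupp m)
  rw [Multiset.toFinsupp_toMultiset] at this
  exact this.symm

/-- Theorem 2.6 (degree bound): if `G` decomposes over the non-adjacent vertex pair
`{u, v}` into parts `L` and `R`, with a path from `u` to `v` on each side, the cut
ideals of `G[L] + uv` and `G[R] + uv` are generated in degrees at most `a` and `b`,
and the cut ideals of `G[L]` and `G[R]` have slow-varying binomial generating sets of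
degrees at most `c` and `d` respectively, then the cut ideal of `G` is generated by
polynomials of degree at most `max {2c - 2, 2d - 2, a, b}`. -/
theorem cutIdeal_degree_bound_of_decomposition
    (K : Type) [Field K] {V : Type} [Fintype V] [DecidableEq V]
    (G : SimpleGraph V) (u v : V) (huv : u ≠ v) (hadj : ¬ G.Adj u v)
    (L R : Finset V) (hLR : L ∪ R = Finset.univ) (hI : L ∩ R = {u, v})
    (huL : u ∈ L) (hvL : v ∈ L) (huR : u ∈ R) (hvR : v ∈ R)
    (hE : ∀ x y, G.Adj x y → (x ∈ L ∧ y ∈ L) ∨ (x ∈ R ∧ y ∈ R))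
    (hpathL : (G.comap (Subtype.val : {x : V // x ∈ L} → V)).Reachable ⟨u, huL⟩ ⟨v, hvL⟩)
    (hpathR : (G.comap (Subtype.val : {x : V // x ∈ R} → V)).Reachable ⟨u, huR⟩ ⟨v, hvR⟩)
    (a b c d : ℕ)
    -- `I_{G[L]+uv}` is generated in degree at most `a`
    (ha : ∃ S : Set (MvPolynomial {B : Finset {x : V // x ∈ L} // ⟨u, huL⟩ ∈ B} K),
      Ideal.span S =
        cutIdeal K (addEdge (G.comap (Subtype.val : {x : V // x ∈ L} → V))
          ⟨u, huL⟩ ⟨v, hvL⟩) ⟨u, huL⟩ ∧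
      ∀ p ∈ S, p.totalDegree ≤ a)
    -- `I_{G[R]+uv}` is generated in degree at most `b`
    (hb : ∃ S : Set (MvPolynomial {B : Finset {x : V // x ∈ R} // ⟨u, huR⟩ ∈ B} K),
      Ideal.span S =
        cutIdeal K (addEdge (G.comap (Subtype.val : {x : V // x ∈ R} → V))
          ⟨u, huR⟩ ⟨v, hvR⟩) ⟨u, huR⟩ ∧
      ∀ p ∈ S, p.totalDegree ≤ b)
    -- `I_{G[L]}` has a slow-varying binomial generating set in degree at most `c`
    (SL : Set (Multiset {B : Finset {x : V // x ∈ L} // ⟨u, huL⟩ ∈ B} ×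
               Multiset {B : Finset {x : V // x ∈ L} // ⟨u, huL⟩ ∈ B}))
    (hSLgen : Ideal.span ((fun p => mon K p.1 - mon K p.2) '' SL) =
      cutIdeal K (G.comap (Subtype.val : {x : V // x ∈ L} → V)) ⟨u, huL⟩)
    (hSLslow : ∀ p ∈ SL,
      ((height (⟨u, huL⟩ : {x : V // x ∈ L}) ⟨v, hvL⟩ p.1 : ℤ) -
        (height (⟨u, huL⟩ : {x : V // x ∈ L}) ⟨v, hvL⟩ p.2 : ℤ)).natAbs ≤ 2)
    (hSLdeg : ∀ p ∈ SL, Multiset.card p.1 ≤ c ∧ Multiset.card p.2 ≤ c)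
    -- `I_{G[R]}` has a slow-varying binomial generating set in degree at most `d`
    (SR : Set (Multiset {B : Finset {x : V // x ∈ R} // ⟨u, huR⟩ ∈ B} ×
               Multiset {B : Finset {x : V // x ∈ R} // ⟨u, huR⟩ ∈ B}))
    (hSRgen : Ideal.span ((fun p => mon K p.1 - mon K p.2) '' SR) =
      cutIdeal K (G.comap (Subtype.val : {x : V // x ∈ R} → V)) ⟨u, huR⟩)
    (hSRslow : ∀ p ∈ SR,
      ((height (⟨u, huR⟩ : {x : V // x ∈ R}) ⟨v, hvR⟩ p.1 : ℤ) -
        (height (⟨u, huR⟩ : {x : V // x ∈ R}) ⟨v, hvR⟩ p.2 : ℤ)).natAbs ≤ 2)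
    (hSRdeg : ∀ p ∈ SR, Multiset.card p.1 ≤ d ∧ Multiset.card p.2 ≤ d) :
    ∃ S : Set (MvPolynomial {A : Finset V // u ∈ A} K),
      Ideal.span S = cutIdeal K G u ∧
      ∀ p ∈ S, p.totalDegree ≤ max (max (2 * c - 2) (2 * d - 2)) (max a b) := by
  classical
  have adjL : ¬ (G.comap (Subtype.val : {x : V // x ∈ L} → V)).Adj ⟨u, huL⟩ ⟨v, hvL⟩ := hadj
  have adjR : ¬ (G.comap (Subtype.val : {x : V // x ∈ R} → V)).Adj ⟨u, huR⟩ ⟨v, hvR⟩ := hadj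
  have neL : (⟨u, huL⟩ : {x : V // x ∈ L}) ≠ ⟨v, hvL⟩ := by simpa using huv
  have neR : (⟨u, huR⟩ : {x : V // x ∈ R}) ≠ ⟨v, hvR⟩ := by simpa using huv
  have cardL := side_card _ _ _ neL hpathL
  have cardR := side_card _ _ _ neR hpathR
  have sX := side_cross K _ _ _ hpathL c SL hSLgen hSLslow hSLdeg cardL
  have sY := side_cross K _ _ _ hpathR d SR hSRgen hSRslow hSRdeg cardR
  have hc : 2 ≤ c := by
    obtain ⟨l, l', h1, h2⟩ := side_quad _ _ _ neL adjL
    obtain ⟨l0, x, x', -, -, -, h3, h4, h5⟩ := sX l l' h1 h2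
    have := Multiset.count_le_card true
      (x'.map fun A => sep A.1 s((⟨u, huL⟩ : {x : V // x ∈ L}), ⟨v, hvL⟩))
    rw [Multiset.card_map] at this
    omega
  set D := max (max (2 * c - 2) (2 * d - 2)) (max a b) with hD
  have hcD : 2 * c - 2 ≤ D := by omega
  have hdD : 2 * d - 2 ≤ D := by omega
  have haD : a ≤ D := by omega
  have hbD : b ≤ D := by omega
  have h2D : 2 ≤ D := by omega
  let S : Set (MvPolynomial {A : Finset V // u ∈ A} K) :=
    {f | ∃ p q : Multiset {A : Finset V // u ∈ A}, p.card ≤ D ∧ q.card ≤ D ∧ fib G u p q ∧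
      f = mon K p - mon K q}
  have hSle : Ideal.span S ≤ cutIdeal K G u := by
    rw [Ideal.span_le]
    rintro f ⟨p, q, -, -, h, rfl⟩
    exact (cutMap_mon_eq_iff K G u p q).2 h
  have memLR : ∀ x, x ∈ L ∨ x ∈ R := by
    intro x
    have : x ∈ L ∪ R := by rw [hLR]; simp
    simpa using this
  have memI : ∀ x, x ∈ L → x ∈ R → x = u ∨ x = v := by
    intro x h1 h2
    have : x ∈ L ∩ R := by simp [h1, h2]
    rw [hI] at this
    simpa using this
  let pL : {A : Finset V // u ∈ A} → {B : Finset {x : V // x ∈ L} // ⟨u, huL⟩ ∈ B} :=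
    fun A => ⟨A.1.subtype (· ∈ L), by simpa using A.2⟩
  let pR : {A : Finset V // u ∈ A} → {B : Finset {x : V // x ∈ R} // ⟨u, huR⟩ ∈ B} :=
    fun A => ⟨A.1.subtype (· ∈ R), by simpa using A.2⟩
  have hpL : ∀ (A : {A : Finset V // u ∈ A}) (x : V) (hx : x ∈ L),
      (⟨x, hx⟩ : {x : V // x ∈ L}) ∈ (pL A).1 ↔ x ∈ A.1 := by
    intro A x hx; simp [pL]
  have hpR : ∀ (A : {A : Finset V // u ∈ A}) (x : V) (hx : x ∈ R),
      (⟨x, hx⟩ : {x : V // x ∈ R}) ∈ (pR A).1 ↔ x ∈ A.1 := by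
    intro A x hx; simp [pR]
  have sepL : ∀ (A : {A : Finset V // u ∈ A}) (x y : V) (hx : x ∈ L) (hy : y ∈ L),
      sep (pL A).1 s((⟨x, hx⟩ : {x : V // x ∈ L}), ⟨y, hy⟩) = sep A.1 s(x, y) := by
    intro A x y hx hy
    simp only [sep_mk, hpL]
  have sepR : ∀ (A : {A : Finset V // u ∈ A}) (x y : V) (hx : x ∈ R) (hy : y ∈ R),
      sep (pR A).1 s((⟨x, hx⟩ : {x : V // x ∈ R}), ⟨y, hy⟩) = sep A.1 s(x, y) := by
    intro A x y hx hy
    simp only [sep_mk, hpR]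
  have hfib : ∀ p q : Multiset {A : Finset V // u ∈ A}, fib G u p q ↔
      fib (G.comap (Subtype.val : {x : V // x ∈ L} → V)) ⟨u, huL⟩ (p.map pL) (q.map pL) ∧
      fib (G.comap (Subtype.val : {x : V // x ∈ R} → V)) ⟨u, huR⟩ (p.map pR) (q.map pR) := by
    intro p q
    constructor
    · intro h
      constructor
      · rintro ⟨x, hx⟩ ⟨y, hy⟩ hxy
        simp only [Multiset.map_map, Function.comp_def, sepL]
        exact h x y hxy
      · rintro ⟨x, hx⟩ ⟨y, hy⟩ hxy
        simp only [Multiset.map_map, Function.comp_def, sepR]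
        exact h x y hxy
    · rintro ⟨h1, h2⟩ x y hxy
      rcases hE x y hxy with ⟨hx, hy⟩ | ⟨hx, hy⟩
      · have := h1 ⟨x, hx⟩ ⟨y, hy⟩ hxy
        simpa only [Multiset.map_map, Function.comp_def, sepL] using this
      · have := h2 ⟨x, hx⟩ ⟨y, hy⟩ hxy
        simpa only [Multiset.map_map, Function.comp_def, sepR] using this
  have hconn : ∀ p q, fib G u p q → mon K p - mon K q ∈ Ideal.span S := by
    intro p q hpq
    rw [hfib] at hpq
    refine all_connected pL pR
      (fun B => sep B.1 s((⟨u, huL⟩ : {x : V // x ∈ L}), ⟨v, hvL⟩))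
      (fun B => sep B.1 s((⟨u, huR⟩ : {x : V // x ∈ R}), ⟨v, hvR⟩)) ?_ ?_ ?_
      (fib (G.comap (Subtype.val : {x : V // x ∈ L} → V)) ⟨u, huL⟩)
      (fib (G.comap (Subtype.val : {x : V // x ∈ R} → V)) ⟨u, huR⟩)
      c d D h2D hcD hdD (idealCon K (Ideal.span S)) ?_ ?_ ?_ ?_ sX sY cardL
      (fib_parity _ _ _ _ hpathL) p q hpq.1 hpq.2
    · intro z
      simp only [sepL, sepR]
    · intro z z' h1 h2
      apply Subtype.ext
      ext x
      rcases memLR x with hx | hx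
      · rw [← hpL z x hx, h1, hpL]
      · rw [← hpR z x hx, h2, hpR]
    · rintro ⟨B, hB⟩ ⟨C, hC⟩ hBC
      have hv : (⟨v, hvL⟩ : {x : V // x ∈ L}) ∈ B ↔ (⟨v, hvR⟩ : {x : V // x ∈ R}) ∈ C := by
        simpa [sep_mk, hB, hC] using hBC
      have hcompat : ∀ x (h1 : x ∈ L) (h2 : x ∈ R),
          ((⟨x, h1⟩ : {x : V // x ∈ L}) ∈ B ↔ (⟨x, h2⟩ : {x : V // x ∈ R}) ∈ C) := by
        intro x h1 h2
        rcases memI x h1 h2 with rfl | rfl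
        · exact iff_of_true hB hC
        · exact hv
      refine ⟨⟨B.map (Function.Embedding.subtype _) ∪ C.map (Function.Embedding.subtype _), ?_⟩,
        ?_, ?_⟩
      · rw [Finset.mem_union]
        left
        exact Finset.mem_map.2 ⟨_, hB, rfl⟩
      · apply Subtype.ext
        ext ⟨x, hx⟩
        rw [hpL, Finset.mem_union, Finset.mem_map, Finset.mem_map]
        constructor
        · rintro (⟨⟨y, hy⟩, h, rfl⟩ | ⟨⟨y, hy⟩, h, rfl⟩)
          · exact h
          · exact (hcompat y hx hy).2 h
        · intro h
          exact Or.inl ⟨_, h, rfl⟩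
      · apply Subtype.ext
        ext ⟨x, hx⟩
        rw [hpR, Finset.mem_union, Finset.mem_map, Finset.mem_map]
        constructor
        · rintro (⟨⟨y, hy⟩, h, rfl⟩ | ⟨⟨y, hy⟩, h, rfl⟩)
          · exact (hcompat y hy hx).1 h
          · exact h
        · intro h
          exact Or.inr ⟨_, h, rfl⟩
    · intro p q hp hq h1 h2
      exact Ideal.subset_span ⟨p, q, hp, hq, (hfib p q).2 ⟨h1, h2⟩, rfl⟩
    · intro p q h
      exact (hfib p q).1 ((cutMap_mon_eq_iff K G u p q).1 (hSle h))
    · intro s hs p q h1 h2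
      exact side_same K _ _ _ neL a ha s
        (fun p q hp hq => hs p q (hp.trans haD) (hq.trans haD)) p q h1 h2
    · intro s hs p q h1 h2
      exact side_same K _ _ _ neR b hb s
        (fun p q hp hq => hs p q (hp.trans hbD) (hq.trans hbD)) p q h1 h2
  refine ⟨S, le_antisymm hSle (connected_span K G u _ hconn), ?_⟩
  rintro f ⟨p, q, hp, hq, -, rfl⟩
  refine (totalDegree_sub _ _).trans (max_le ?_ ?_)
  · exact (totalDegree_mon_le K p).trans hp
  · exact (totalDegree_mon_le K q).trans hq

end
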